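/- Let P_1,…,P_s ∈ ℤ[x_1,…,x_r] (s ≥ 2, r ≥ 1) be nonzero coprime polynomials, and suppose there is no prime p dividing P_i(n) for every i = 1,…,s and every n ∈ ℤ^r. Then the set ℛ = {n ∈ ℤ^r : gcd(P_1(n),…,P_s(n)) = 1} has positive density: μ(ℛ) exists and μ(ℛ) > 0. -/

import Mathlib

open MvPolynomial Filter

namespace CoprimeValues

/-- Every common divisor of the members of `F` is a nonzero constant. -/
def IsCoprimeFamily {r : ℕ} (F : Finset (MvPolynomial (Fin r) ℤ)) : Prop :=
  ∀ D, (∀ P ∈ F, D ∣ P) → ∃ c : ℤ, c ≠ 0 ∧ D = C c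

open Classical in
/-- The nonzero coefficients of the members of `F`, seen as polynomials in the first variable. -/
noncomputable def coeffFamily {r : ℕ} (F : Finset (MvPolynomial (Fin (r + 1)) ℤ)) :
    Finset (MvPolynomial (Fin r) ℤ) :=
  F.biUnion fun P => (finSuccEquiv ℤ r P).coeffs

lemma finSuccEquiv_C {r : ℕ} (c : ℤ) :
    finSuccEquiv ℤ r (C c) = Polynomial.C (C c) := by
  simp

lemma IsCoprimeFamily.dvd_finSuccEquiv {r : ℕ} {F : Finset (MvPolynomial (Fin (r + 1)) ℤ)}
    (hF : IsCoprimeFamily F) (g : Polynomial (MvPolynomial (Fin r) ℤ))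
    (hg : ∀ P ∈ F, g ∣ finSuccEquiv ℤ r P) :
    ∃ c : ℤ, c ≠ 0 ∧ g = Polynomial.C (C c) := by
  obtain ⟨c, hc, h⟩ := hF ((finSuccEquiv ℤ r).symm g) fun P hP => by
    have := map_dvd (finSuccEquiv ℤ r).symm (hg P hP)
    simpa using this
  refine ⟨c, hc, ?_⟩
  rw [← finSuccEquiv_C, ← h, AlgEquiv.apply_symm_apply]

lemma IsCoprimeFamily.coeffs {r : ℕ} {F : Finset (MvPolynomial (Fin (r + 1)) ℤ)}
    (hF : IsCoprimeFamily F) : IsCoprimeFamily (coeffFamily F) := by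
  intro D hD
  obtain ⟨c, hc, h⟩ := hF.dvd_finSuccEquiv (Polynomial.C D) fun P hP => by
    rw [Polynomial.C_dvd_iff_dvd_coeff]
    intro k
    by_cases hk : (finSuccEquiv ℤ r P).coeff k = 0
    · simp [hk]
    · exact hD _ (Finset.mem_biUnion.2 ⟨P, hP, Polynomial.coeff_mem_coeffs hk⟩)
  exact ⟨c, hc, Polynomial.C_injective h⟩

/-- A nonzero polynomial over the fraction field divides the same integral polynomials as some
primitive integral polynomial. -/
lemma exists_isPrimitive_dvd {A K : Type*} [CommRing A] [IsDomain A]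
    [UniqueFactorizationMonoid A] [Field K] [Algebra A K] [IsFractionRing A K]
    (g : Polynomial K) (hg : g ≠ 0) :
    ∃ h : Polynomial A, Associated (h.map (algebraMap A K)) g ∧
      ∀ q : Polynomial A, g ∣ q.map (algebraMap A K) → h ∣ q := by
  classical
  let _ : StrongNormalizationMonoid A := UniqueFactorizationMonoid.strongNormalizationMonoid
  let _ : NormalizedGCDMonoid A := UniqueFactorizationMonoid.toNormalizedGCDMonoid A
  obtain ⟨b, hb, hbg⟩ := IsLocalization.integerNormalization_spec (nonZeroDivisors A) g
  set f := IsLocalization.integerNormalization (nonZeroDivisors A) g with hf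
  have hb0 : algebraMap A K b ≠ 0 := by
    simpa using nonZeroDivisors.ne_zero hb
  have hbg' : f.map (algebraMap A K) = Polynomial.C (algebraMap A K b) * g := by
    rw [hbg, ← Polynomial.smul_eq_C_mul, algebraMap_smul]
  have hf0 : f ≠ 0 := by
    intro h0
    rw [h0, Polynomial.map_zero] at hbg'
    exact mul_ne_zero (Polynomial.C_ne_zero.2 hb0) hg hbg'.symm
  have hc0 : algebraMap A K f.content ≠ 0 := by
    simpa using mt Polynomial.content_eq_zero_iff.1 hf0
  have hass : Associated (f.primPart.map (algebraMap A K)) g := by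
    have h1 : Associated (f.map (algebraMap A K)) g := by
      rw [hbg']
      exact associated_unit_mul_left g _ (Polynomial.isUnit_C.2 hb0.isUnit)
    refine Associated.trans ?_ h1
    conv_rhs => rw [f.eq_C_content_mul_primPart, Polynomial.map_mul, Polynomial.map_C]
    exact (associated_unit_mul_left _ _ (Polynomial.isUnit_C.2 hc0.isUnit)).symm
  refine ⟨f.primPart, hass, fun q hq => ?_⟩
  exact f.isPrimitive_primPart.dvd_of_fraction_map_dvd_fraction_map (hass.dvd.trans hq)

/-- Elimination of the first variable. -/
lemma IsCoprimeFamily.exists_C_mem_span {r : ℕ} {F : Finset (MvPolynomial (Fin (r + 1)) ℤ)}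
    (hF : IsCoprimeFamily F) :
    ∃ R : MvPolynomial (Fin r) ℤ, R ≠ 0 ∧
      Polynomial.C R ∈ Ideal.span ((finSuccEquiv ℤ r) '' (F : Set (MvPolynomial (Fin (r + 1)) ℤ))) := by
  set A := MvPolynomial (Fin r) ℤ
  let K := FractionRing A
  let _ : Algebra (Polynomial A) (Polynomial K) := Polynomial.algebra A K
  have : IsLocalization (Submonoid.map Polynomial.C (nonZeroDivisors A)) (Polynomial K) :=
    Polynomial.isLocalization (nonZeroDivisors A) K
  set I := Ideal.span ((finSuccEquiv ℤ r) '' (F : Set (MvPolynomial (Fin (r + 1)) ℤ)))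
  have htop : I.map (algebraMap (Polynomial A) (Polynomial K)) = ⊤ := by
    obtain ⟨g, hg⟩ : ∃ g, I.map (algebraMap (Polynomial A) (Polynomial K)) = Ideal.span {g} :=
      (IsPrincipalIdealRing.principal _).principal
    have hdvd : ∀ P ∈ F, g ∣ (finSuccEquiv ℤ r P).map (algebraMap A K) := fun P hP => by
      rw [← Ideal.mem_span_singleton, ← hg]
      exact Ideal.mem_map_of_mem (algebraMap (Polynomial A) (Polynomial K))
        (Ideal.subset_span ⟨P, hP, rfl⟩)
    have hg0 : g ≠ 0 := by
      rintro rfl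
      obtain ⟨c, hc, h⟩ := hF 0 fun P hP => by
        have h0 := zero_dvd_iff.1 (hdvd P hP)
        rw [Polynomial.map_eq_zero_iff (IsFractionRing.injective A K)] at h0
        rw [zero_dvd_iff]
        exact (finSuccEquiv ℤ r).injective (by rw [h0, map_zero])
      exact hc (C_injective (Fin (r + 1)) ℤ (by rw [← h, C_0]))
    obtain ⟨h, hass, hh⟩ := exists_isPrimitive_dvd (A := A) g hg0
    obtain ⟨c, hc, rfl⟩ := hF.dvd_finSuccEquiv h fun P hP => hh _ (hdvd P hP)
    rw [hg, Ideal.span_singleton_eq_top]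
    refine hass.isUnit ?_
    rw [Polynomial.map_C, Polynomial.isUnit_C, isUnit_iff_ne_zero]
    intro h0
    rw [map_eq_zero_iff _ (IsFractionRing.injective A K)] at h0
    exact hc (C_injective (Fin r) ℤ (by rw [h0, C_0]))
  have hnd := mt (IsLocalization.map_algebraMap_ne_top_iff_disjoint
    (Submonoid.map Polynomial.C (nonZeroDivisors A)) (Polynomial K) I).2 (not_not.2 htop)
  rw [Set.not_disjoint_iff] at hnd
  obtain ⟨_, ⟨R, hR, rfl⟩, hRI⟩ := hnd
  exact ⟨R, nonZeroDivisors.ne_zero hR, hRI⟩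

lemma aeval_cons {r : ℕ} {K : Type*} [CommRing K] (v : Fin r → K) (y : K)
    (P : MvPolynomial (Fin (r + 1)) ℤ) :
    aeval (Fin.cons y v : Fin (r + 1) → K) P =
      Polynomial.eval y ((finSuccEquiv ℤ r P).map (aeval v : _ →ₐ[ℤ] K).toRingHom) := by
  induction P using MvPolynomial.induction_on with
  | C a => simp
  | add p q hp hq => simp only [map_add, hp, hq, Polynomial.map_add, Polynomial.eval_add]
  | mul_X p i hp =>
    simp only [map_mul, hp, Polynomial.map_mul, Polynomial.eval_mul, aeval_X]
    congr 1
    refine Fin.cases ?_ (fun j => ?_) i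
    · simp [finSuccEquiv_X_zero]
    · simp [finSuccEquiv_X_succ]

lemma aeval_eq_zero_of_mem_span {r : ℕ} {F : Finset (MvPolynomial (Fin (r + 1)) ℤ)}
    {R : MvPolynomial (Fin r) ℤ}
    (hR : Polynomial.C R ∈
      Ideal.span ((finSuccEquiv ℤ r) '' (F : Set (MvPolynomial (Fin (r + 1)) ℤ))))
    {K : Type*} [CommRing K] (v : Fin r → K) (y : K)
    (h : ∀ P ∈ F, aeval (Fin.cons y v : Fin (r + 1) → K) P = 0) : aeval v R = 0 := by
  let ψ : Polynomial (MvPolynomial (Fin r) ℤ) →+* K :=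
    (Polynomial.evalRingHom y).comp (Polynomial.mapRingHom (aeval v : _ →ₐ[ℤ] K).toRingHom)
  have hle : Ideal.span ((finSuccEquiv ℤ r) '' (F : Set (MvPolynomial (Fin (r + 1)) ℤ))) ≤
      RingHom.ker ψ := by
    rw [Ideal.span_le]
    rintro _ ⟨P, hP, rfl⟩
    have := h P hP
    rw [aeval_cons] at this
    simpa [ψ, RingHom.mem_ker] using this
  have hψ : ψ (Polynomial.C R) = 0 := hle hR
  simp only [ψ, RingHom.comp_apply, Polynomial.coe_mapRingHom, Polynomial.map_C,
    Polynomial.coe_evalRingHom, Polynomial.eval_C] at hψ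
  exact hψ

/-- A bound for the degree in the first variable of the members of `F`. -/
noncomputable def degBound {r : ℕ} (F : Finset (MvPolynomial (Fin (r + 1)) ℤ)) : ℕ :=
  F.sup fun P => (finSuccEquiv ℤ r P).natDegree

lemma card_le_degBound {r : ℕ} (F : Finset (MvPolynomial (Fin (r + 1)) ℤ))
    {K : Type*} [CommRing K] [IsDomain K] (v : Fin r → K)
    (hv : ∃ Q ∈ coeffFamily F, aeval v Q ≠ 0) (T : Finset K)
    (hT : ∀ y ∈ T, ∀ P ∈ F, aeval (Fin.cons y v : Fin (r + 1) → K) P = 0) :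
    T.card ≤ degBound F := by
  classical
  obtain ⟨Q, hQ, hQv⟩ := hv
  obtain ⟨P, hP, hQP⟩ := Finset.mem_biUnion.1 hQ
  obtain ⟨k, -, rfl⟩ := Polynomial.mem_coeffs_iff.1 hQP
  set q := (finSuccEquiv ℤ r P).map (aeval v : _ →ₐ[ℤ] K).toRingHom with hq
  have hq0 : q ≠ 0 := by
    intro h
    apply hQv
    have := congrArg (fun f => Polynomial.coeff f k) h
    simpa [hq, Polynomial.coeff_map] using this
  calc T.card ≤ q.roots.toFinset.card := Finset.card_le_card fun y hy => by
        rw [Multiset.mem_toFinset, Polynomial.mem_roots hq0, Polynomial.IsRoot.def, hq, ← aeval_cons]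
        exact hT y hy P hP
    _ ≤ q.roots.card := Multiset.toFinset_card_le _
    _ ≤ q.natDegree := q.card_roots'
    _ ≤ (finSuccEquiv ℤ r P).natDegree := Polynomial.natDegree_map_le
    _ ≤ degBound F := Finset.le_sup (f := fun P => (finSuccEquiv ℤ r P).natDegree) hP

lemma card_zeros_mul_card_le {K : Type*} [CommRing K] [IsDomain K] [DecidableEq K] {r : ℕ}
    {R : MvPolynomial (Fin r) K} (hR : R ≠ 0) (S : Finset K) :
    {v ∈ Fintype.piFinset fun _ : Fin r => S | eval v R = 0}.card * S.card ≤
      R.totalDegree * S.card ^ r := by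
  rcases S.eq_empty_or_nonempty with rfl | hS
  · simp
  have hS' : (0 : ℚ≥0) < S.card := by exact_mod_cast hS.card_pos
  have h := schwartz_zippel_totalDegree hR S
  rw [div_le_div_iff₀ (pow_pos hS' r) hS'] at h
  exact_mod_cast h

lemma card_le_of_fibers {α : Type*} {r : ℕ} (S : Finset α) (T : Finset (Fin (r + 1) → α))
    (U V : Finset (Fin r → α)) (k : ℕ)
    (hT : ∀ x ∈ T, x 0 ∈ S ∧ (Fin.tail x ∈ V ∨ Fin.tail x ∈ U))
    (hk : ∀ v ∈ U, v ∉ V → ∀ T' : Finset α,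
      (∀ y ∈ T', y ∈ S ∧ (Fin.cons y v : Fin (r + 1) → α) ∈ T) → T'.card ≤ k) :
    T.card ≤ V.card * S.card + U.card * k := by
  classical
  let tl : (Fin (r + 1) → α) → Fin r → α := Fin.tail
  rw [← Finset.card_filter_add_card_filter_not (fun x => tl x ∈ V)]
  refine add_le_add ?_ ?_
  · rw [← Finset.card_product]
    refine Finset.card_le_card_of_injOn (fun x => (tl x, x 0)) (fun x hx => ?_) ?_
    · have hx' := Finset.mem_filter.1 hx
      simp [hx'.2, (hT x hx'.1).1]
    · intro x _ y _ hxy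
      obtain ⟨h1, h2⟩ := Prod.ext_iff.1 hxy
      rw [← Fin.cons_self_tail x, ← Fin.cons_self_tail y]
      exact congrArg₂ _ h2 h1
  · rw [mul_comm]
    refine (Finset.card_le_mul_card_image_of_maps_to (f := tl) (t := U \ V) (n := k)
      (fun x hx => ?_) fun v hv => ?_).trans
        (Nat.mul_le_mul_left _ (Finset.card_le_card Finset.sdiff_subset))
    · have hx' := Finset.mem_filter.1 hx
      exact Finset.mem_sdiff.2 ⟨(hT x hx'.1).2.resolve_left hx'.2, hx'.2⟩
    · rw [Finset.mem_sdiff] at hv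
      have hinj : Set.InjOn (fun x : Fin (r + 1) → α => x 0)
          ({x ∈ {x ∈ T | tl x ∉ V} | tl x = v} : Finset (Fin (r + 1) → α)) := by
        intro x hx y hy hxy
        rw [← Fin.cons_self_tail x, ← Fin.cons_self_tail y]
        exact congrArg₂ _ hxy
          ((Finset.mem_filter.1 hx).2.trans (Finset.mem_filter.1 hy).2.symm)
      rw [← Finset.card_image_of_injOn hinj]
      refine hk v hv.1 hv.2 _ fun y hy => ?_
      obtain ⟨x, hx, rfl⟩ := Finset.mem_image.1 hy
      simp only [Finset.mem_filter] at hx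
      refine ⟨(hT x hx.1.1).1, ?_⟩
      rw [← hx.2, Fin.cons_self_tail]
      exact hx.1.1

/-- The number of common zeros of `F` modulo `p`. -/
noncomputable def zeroCount {r : ℕ} (F : Finset (MvPolynomial (Fin r) ℤ)) (p : ℕ) : ℕ :=
  Nat.card {v : Fin r → ZMod p // ∀ P ∈ F, aeval v P = 0}

open Classical in
lemma zeroCount_eq {r : ℕ} (F : Finset (MvPolynomial (Fin r) ℤ)) (p : ℕ) [NeZero p] :
    zeroCount F p = (Finset.univ.filter fun v : Fin r → ZMod p => ∀ P ∈ F, aeval v P = 0).card := by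
  rw [zeroCount, Nat.card_eq_fintype_card, Fintype.card_subtype]

lemma zeroCount_le {r : ℕ} (F : Finset (MvPolynomial (Fin r) ℤ)) (p : ℕ) [NeZero p] :
    zeroCount F p ≤ p ^ r := by
  classical
  rw [zeroCount_eq]
  exact (Finset.card_le_univ _).trans (by simp [ZMod.card])

lemma exists_forall_map_ne_zero {r : ℕ} {R : MvPolynomial (Fin r) ℤ} (hR : R ≠ 0) :
    ∃ c : ℕ, ∀ p : ℕ, c < p → R.map (Int.castRingHom (ZMod p)) ≠ 0 := by
  obtain ⟨m, hm⟩ := MvPolynomial.ne_zero_iff.1 hR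
  refine ⟨(coeff m R).natAbs, fun p hp h => ?_⟩
  have h1 := congrArg (coeff m) h
  rw [coeff_map, coeff_zero, eq_intCast, ZMod.intCast_zmod_eq_zero_iff_dvd,
    Int.natCast_dvd] at h1
  exact absurd (Nat.le_of_dvd (Int.natAbs_pos.2 hm) h1) (not_le.2 hp)

lemma IsCoprimeFamily.exists_ne_zero {F : Finset (MvPolynomial (Fin 0) ℤ)}
    (hF : IsCoprimeFamily F) : ∃ c : ℤ, c ≠ 0 ∧ C c ∈ F := by
  by_contra! h
  obtain ⟨c, hc, h0⟩ := hF 0 fun P hP => by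
    obtain ⟨a, rfl⟩ := C_surjective (Fin 0) P
    by_cases ha : a = 0
    · simp [ha]
    · exact absurd hP (h a ha)
  exact hc (C_injective (Fin 0) ℤ (by rw [← h0, C_0]))

/-- A coprime family has few common zeros modulo `p`. -/
lemma IsCoprimeFamily.exists_zeroCount_le {r : ℕ} {F : Finset (MvPolynomial (Fin r) ℤ)}
    (hF : IsCoprimeFamily F) :
    ∃ c : ℕ, ∀ p : ℕ, p.Prime → zeroCount F p * p ^ 2 ≤ c * p ^ r := by
  classical
  suffices h : ∃ c d : ℕ, ∀ p : ℕ, p.Prime → d < p → zeroCount F p * p ^ 2 ≤ c * p ^ r by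
    obtain ⟨c, d, h⟩ := h
    refine ⟨c + d ^ 2, fun p hp => ?_⟩
    rcases lt_or_ge d p with hd | hd
    · exact (h p hp hd).trans (Nat.mul_le_mul_right _ (Nat.le_add_right _ _))
    · have : NeZero p := ⟨hp.ne_zero⟩
      calc zeroCount F p * p ^ 2 ≤ p ^ r * d ^ 2 :=
            Nat.mul_le_mul (zeroCount_le F p) (Nat.pow_le_pow_left hd 2)
        _ ≤ (c + d ^ 2) * p ^ r := by
            rw [mul_comm]; exact Nat.mul_le_mul_right _ (Nat.le_add_left _ _)
  induction r with
  | zero =>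
    obtain ⟨c, hc, hcF⟩ := hF.exists_ne_zero
    refine ⟨0, c.natAbs, fun p hp hcp => ?_⟩
    have : NeZero p := ⟨hp.ne_zero⟩
    suffices zeroCount F p = 0 by simp [this]
    rw [zeroCount_eq, Finset.card_eq_zero, Finset.filter_eq_empty_iff]
    intro v _ hv
    have h1 := hv _ hcF
    rw [aeval_C, eq_intCast, ZMod.intCast_zmod_eq_zero_iff_dvd, Int.natCast_dvd] at h1
    exact absurd (Nat.le_of_dvd (Int.natAbs_pos.2 hc) h1) (not_le.2 hcp)
  | succ r ih =>
    obtain ⟨c, d, h⟩ := ih hF.coeffs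
    obtain ⟨R, hR0, hR⟩ := hF.exists_C_mem_span
    obtain ⟨e, he⟩ := exists_forall_map_ne_zero hR0
    refine ⟨c + R.totalDegree * degBound F, max d e, fun p hp hdp => ?_⟩
    have : Fact p.Prime := ⟨hp⟩
    have hcoeff := h p hp ((le_max_left _ _).trans_lt hdp)
    have hRp := he p ((le_max_right _ _).trans_lt hdp)
    have hSZ := card_zeros_mul_card_le hRp Finset.univ
    rw [Finset.card_univ, ZMod.card] at hSZ
    have hdeg : (R.map (Int.castRingHom (ZMod p))).totalDegree ≤ R.totalDegree := by
      exact Finset.sup_mono (support_map_subset _ _)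
    have hmain := card_le_of_fibers (Finset.univ : Finset (ZMod p))
      ({v : Fin (r + 1) → ZMod p | ∀ P ∈ F, aeval v P = 0} : Finset _)
      ({v ∈ Fintype.piFinset fun _ : Fin r => (Finset.univ : Finset (ZMod p)) |
        eval v (R.map (Int.castRingHom (ZMod p))) = 0})
      ({v : Fin r → ZMod p | ∀ P ∈ coeffFamily F, aeval v P = 0} : Finset _) (degBound F)
      (fun x hx => by
        refine ⟨Finset.mem_univ _, Or.inr ?_⟩
        simp only [Finset.mem_filter, Finset.mem_univ, true_and, Fintype.mem_piFinset,
          implies_true] at hx ⊢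
        rw [eval_map]
        refine aeval_eq_zero_of_mem_span hR (Fin.tail x) (x 0) ?_
        rwa [Fin.cons_self_tail])
      (fun v _ hvV T' hT' => by
        simp only [Finset.mem_filter, Finset.mem_univ, true_and] at hvV hT'
        push Not at hvV
        exact card_le_degBound F v hvV T' hT')
    rw [← zeroCount_eq, ← zeroCount_eq, Finset.card_univ, ZMod.card] at hmain
    set u := ({v ∈ Fintype.piFinset fun _ : Fin r => (Finset.univ : Finset (ZMod p)) |
        eval v (R.map (Int.castRingHom (ZMod p))) = 0}).card
    calc zeroCount F p * p ^ 2 ≤ (zeroCount (coeffFamily F) p * p + u * degBound F) * p ^ 2 :=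
          Nat.mul_le_mul_right _ hmain
      _ = zeroCount (coeffFamily F) p * p ^ 2 * p + (u * p) * (degBound F * p) := by ring
      _ ≤ c * p ^ r * p + (R.totalDegree * p ^ r) * (degBound F * p) := by
          exact add_le_add (Nat.mul_le_mul_right _ hcoeff)
            (Nat.mul_le_mul_right _ (hSZ.trans (Nat.mul_le_mul_right _ hdeg)))
      _ = _ := by ring

/-- The integer points of `[0, B - 1] ^ r`. -/
noncomputable def box (r B : ℕ) : Finset (Fin r → ℤ) := Fintype.piFinset fun _ => Finset.Ico 0 (B : ℤ)

lemma mem_box {r B : ℕ} {n : Fin r → ℤ} : n ∈ box r B ↔ ∀ j, 0 ≤ n j ∧ n j < (B : ℤ) := by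
  simp [box]

lemma card_box (r B : ℕ) : (box r B).card = B ^ r := by
  simp [box]

lemma intCast_eval {r : ℕ} (p : ℕ) (n : Fin r → ℤ) (P : MvPolynomial (Fin r) ℤ) :
    ((eval n P : ℤ) : ZMod p) = aeval (fun j => (n j : ZMod p)) P := by
  induction P using MvPolynomial.induction_on with
  | C a => simp
  | add p q hp hq => simp only [map_add, Int.cast_add, hp, hq]
  | mul_X p i hp => simp only [map_mul, Int.cast_mul, hp, eval_X, aeval_X]

lemma natCast_dvd_eval_iff {r : ℕ} (p : ℕ) (n : Fin r → ℤ) (P : MvPolynomial (Fin r) ℤ) :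
    (p : ℤ) ∣ eval n P ↔ aeval (fun j => (n j : ZMod p)) P = 0 := by
  rw [← intCast_eval, ZMod.intCast_zmod_eq_zero_iff_dvd]

lemma natCast_dvd_eval_cons_iff {r : ℕ} (p : ℕ) (v : Fin r → ℤ) (y : ℤ)
    (P : MvPolynomial (Fin (r + 1)) ℤ) :
    (p : ℤ) ∣ eval (Fin.cons y v : Fin (r + 1) → ℤ) P ↔
      aeval (Fin.cons (y : ZMod p) fun j => (v j : ZMod p) : Fin (r + 1) → ZMod p) P = 0 := by
  rw [natCast_dvd_eval_iff]
  have h : (fun j => ((Fin.cons y v : Fin (r + 1) → ℤ) j : ZMod p)) =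
      Fin.cons (y : ZMod p) fun j => (v j : ZMod p) := by
    funext j
    refine Fin.cases ?_ (fun i => ?_) j <;> simp
  rw [h]

lemma exists_natAbs_eval_le {r : ℕ} (R : MvPolynomial (Fin r) ℤ) :
    ∃ c d : ℕ, ∀ B : ℕ, 1 ≤ B → ∀ n ∈ box r B, (eval n R).natAbs ≤ c * B ^ d := by
  induction R using MvPolynomial.induction_on with
  | C a => exact ⟨a.natAbs, 0, fun B _ n _ => by simp⟩
  | add p q hp hq =>
    obtain ⟨c, d, h⟩ := hp
    obtain ⟨c', d', h'⟩ := hq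
    refine ⟨c + c', max d d', fun B hB n hn => ?_⟩
    rw [map_add, add_mul]
    refine (Int.natAbs_add_le _ _).trans (add_le_add ?_ ?_)
    · exact (h B hB n hn).trans (Nat.mul_le_mul_left _ (Nat.pow_le_pow_right hB (le_max_left _ _)))
    · exact (h' B hB n hn).trans
        (Nat.mul_le_mul_left _ (Nat.pow_le_pow_right hB (le_max_right _ _)))
  | mul_X p i hp =>
    obtain ⟨c, d, h⟩ := hp
    refine ⟨c, d + 1, fun B hB n hn => ?_⟩
    rw [map_mul, eval_X, Int.natAbs_mul, pow_succ, ← mul_assoc]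
    refine Nat.mul_le_mul (h B hB n hn) ?_
    have := mem_box.1 hn i
    omega

lemma card_primeFactors_filter_le {N B d : ℕ} (hN : N ≠ 0) (hB : 1 ≤ B) (h : N < B ^ (d + 1)) :
    (N.primeFactors.filter fun p => B ≤ p).card ≤ d := by
  by_contra! hd
  refine absurd h (not_lt.2 ?_)
  calc B ^ (d + 1) ≤ B ^ (N.primeFactors.filter fun p => B ≤ p).card := Nat.pow_le_pow_right hB hd
    _ = ∏ _p ∈ N.primeFactors.filter fun p => B ≤ p, B := by rw [Finset.prod_const]
    _ ≤ ∏ p ∈ N.primeFactors.filter fun p => B ≤ p, p :=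
        Finset.prod_le_prod' fun p hp => (Finset.mem_filter.1 hp).2
    _ ≤ N := Nat.le_of_dvd (Nat.pos_of_ne_zero hN)
        ((Finset.prod_dvd_prod_of_subset _ _ _ (Finset.filter_subset _ _)).trans
          (Nat.prod_primeFactors_dvd N))

open Classical in
/-- The points of the box at which the members of `F` have a common prime factor `p ≥ B`. -/
noncomputable def largeBad {r : ℕ} (F : Finset (MvPolynomial (Fin r) ℤ)) (B : ℕ) :
    Finset (Fin r → ℤ) :=
  (box r B).filter fun n => ∃ p : ℕ, p.Prime ∧ B ≤ p ∧ ∀ P ∈ F, (p : ℤ) ∣ eval n P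

lemma mem_largeBad {r : ℕ} {F : Finset (MvPolynomial (Fin r) ℤ)} {B : ℕ} {n : Fin r → ℤ} :
    n ∈ largeBad F B ↔ n ∈ box r B ∧
      ∃ p : ℕ, p.Prime ∧ B ≤ p ∧ ∀ P ∈ F, (p : ℤ) ∣ eval n P := by
  classical
  simp [largeBad]

lemma card_fiber_prime_le {r : ℕ} (F : Finset (MvPolynomial (Fin (r + 1)) ℤ)) {B p : ℕ}
    (hp : p.Prime) (hBp : B ≤ p) (v : Fin r → ℤ)
    (hv : ∃ Q ∈ coeffFamily F, ¬ (p : ℤ) ∣ eval v Q) (T : Finset ℤ)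
    (hT : ∀ y ∈ T, y ∈ Finset.Ico 0 (B : ℤ) ∧
      ∀ P ∈ F, (p : ℤ) ∣ eval (Fin.cons y v : Fin (r + 1) → ℤ) P) :
    T.card ≤ degBound F := by
  classical
  have : Fact p.Prime := ⟨hp⟩
  have hinj : Set.InjOn (fun y : ℤ => (y : ZMod p)) T := by
    intro x hx y hy hxy
    have h1 := Finset.mem_Ico.1 (hT x hx).1
    have h2 := Finset.mem_Ico.1 (hT y hy).1
    have h3 := (ZMod.intCast_eq_intCast_iff x y p).1 hxy
    rw [Int.ModEq, Int.emod_eq_of_lt h1.1 (by omega), Int.emod_eq_of_lt h2.1 (by omega)] at h3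
    exact h3
  rw [← Finset.card_image_of_injOn hinj]
  simp only [natCast_dvd_eval_iff] at hv
  refine card_le_degBound F _ hv _ fun y hy P hP => ?_
  obtain ⟨x, hx, rfl⟩ := Finset.mem_image.1 hy
  exact (natCast_dvd_eval_cons_iff _ _ _ _).1 ((hT x hx).2 P hP)

/-- Few points of the box have a common prime factor exceeding the side of the box. -/
lemma IsCoprimeFamily.exists_card_largeBad_le {r : ℕ} {F : Finset (MvPolynomial (Fin r) ℤ)}
    (hF : IsCoprimeFamily F) : ∃ c : ℕ, ∀ B : ℕ, (largeBad F B).card * B ≤ c * B ^ r := by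
  classical
  suffices h : ∃ c d : ℕ, ∀ B : ℕ, d < B → (largeBad F B).card * B ≤ c * B ^ r by
    obtain ⟨c, d, h⟩ := h
    refine ⟨c + d, fun B => ?_⟩
    rcases lt_or_ge d B with hd | hd
    · exact (h B hd).trans (Nat.mul_le_mul_right _ (Nat.le_add_right _ _))
    · calc (largeBad F B).card * B ≤ B ^ r * d := by
            refine Nat.mul_le_mul ?_ hd
            rw [← card_box]
            exact Finset.card_le_card (Finset.filter_subset _ _)
        _ ≤ (c + d) * B ^ r := by
            rw [mul_comm]; exact Nat.mul_le_mul_right _ (Nat.le_add_left _ _)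
  induction r with
  | zero =>
    obtain ⟨c, hc, hcF⟩ := hF.exists_ne_zero
    refine ⟨0, c.natAbs, fun B hB => ?_⟩
    suffices largeBad F B = ∅ by simp [this]
    rw [Finset.eq_empty_iff_forall_notMem]
    intro n hn
    obtain ⟨-, p, -, hBp, h⟩ := mem_largeBad.1 hn
    have h1 := h _ hcF
    rw [eval_C, Int.natCast_dvd] at h1
    exact absurd (Nat.le_of_dvd (Int.natAbs_pos.2 hc) h1) (by omega)
  | succ r ih =>
    obtain ⟨c, d, h⟩ := ih hF.coeffs
    obtain ⟨R, hR0, hR⟩ := hF.exists_C_mem_span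
    obtain ⟨e, m, he⟩ := exists_natAbs_eval_le R
    refine ⟨R.totalDegree + c + m * degBound F, max d e, fun B hB => ?_⟩
    have hdB : d < B := (le_max_left _ _).trans_lt hB
    have heB : e < B := (le_max_right _ _).trans_lt hB
    have hB1 : 1 ≤ B := by omega
    have hSZ := card_zeros_mul_card_le hR0 (Finset.Ico 0 (B : ℤ))
    have hcard : (Finset.Ico 0 (B : ℤ)).card = B := by simp
    rw [hcard] at hSZ
    set Z := (Fintype.piFinset fun _ : Fin r => Finset.Ico 0 (B : ℤ)).filter
      fun v => eval v R = 0 with hZ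
    have hmain := card_le_of_fibers (Finset.Ico 0 (B : ℤ)) (largeBad F B) (box r B)
      (Z ∪ largeBad (coeffFamily F) B) (m * degBound F)
      (fun x hx => by
        have hx' := mem_box.1 (mem_largeBad.1 hx).1
        exact ⟨by simpa using hx' 0, Or.inr (mem_box.2 fun j => hx' j.succ)⟩)
      (fun v hv hvV T hT => by
        rw [Finset.mem_union, not_or] at hvV
        have hvR : eval v R ≠ 0 := fun h0 => hvV.1 (Finset.mem_filter.2 ⟨hv, h0⟩)
        have hvb := hvV.2
        rw [mem_largeBad] at hvb
        push Not at hvb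
        set S := ((eval v R).natAbs.primeFactors.filter fun p => B ≤ p) with hS
        have hScard : S.card ≤ m := by
          refine card_primeFactors_filter_le (Int.natAbs_ne_zero.2 hvR) hB1 ?_
          refine (he B hB1 v hv).trans_lt ?_
          rw [pow_succ, mul_comm]
          exact Nat.mul_lt_mul_of_pos_left heB (pow_pos hB1 m)
        let W : ℕ → Finset ℤ := fun p => T.filter fun y =>
          ∀ P ∈ F, (p : ℤ) ∣ eval (Fin.cons y v : Fin (r + 1) → ℤ) P
        have hcover : T ⊆ S.biUnion W := by
          intro y hy
          obtain ⟨-, p, hp, hBp, hdvd⟩ := mem_largeBad.1 (hT y hy).2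
          refine Finset.mem_biUnion.2 ⟨p, ?_, Finset.mem_filter.2 ⟨hy, hdvd⟩⟩
          refine Finset.mem_filter.2 ⟨Nat.mem_primeFactors.2
            ⟨hp, ?_, Int.natAbs_ne_zero.2 hvR⟩, hBp⟩
          rw [← Int.natCast_dvd, natCast_dvd_eval_iff]
          exact aeval_eq_zero_of_mem_span hR _ (y : ZMod p) fun P hP =>
            (natCast_dvd_eval_cons_iff _ _ _ _).1 (hdvd P hP)
        calc T.card ≤ (S.biUnion W).card := Finset.card_le_card hcover
          _ ≤ S.card * degBound F := Finset.card_biUnion_le_card_mul _ _ _ fun p hp => by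
              obtain ⟨hp1, hBp⟩ := Finset.mem_filter.1 hp
              have hpp := Nat.prime_of_mem_primeFactors hp1
              refine card_fiber_prime_le F hpp hBp v (hvb hv p hpp hBp) _ fun y hy => ?_
              obtain ⟨hy1, hy2⟩ := Finset.mem_filter.1 hy
              exact ⟨(hT y hy1).1, hy2⟩
          _ ≤ m * degBound F := Nat.mul_le_mul_right _ hScard)
    rw [hcard, card_box] at hmain
    have hU : (Z ∪ largeBad (coeffFamily F) B).card * B ≤ (R.totalDegree + c) * B ^ r :=
      calc _ ≤ (Z.card + (largeBad (coeffFamily F) B).card) * B :=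
            Nat.mul_le_mul_right _ (Finset.card_union_le _ _)
        _ = Z.card * B + (largeBad (coeffFamily F) B).card * B := by ring
        _ ≤ R.totalDegree * B ^ r + c * B ^ r := add_le_add hSZ (h B hdB)
        _ = _ := by ring
    calc (largeBad F B).card * B
        ≤ ((Z ∪ largeBad (coeffFamily F) B).card * B + B ^ r * (m * degBound F)) * B :=
          Nat.mul_le_mul_right _ hmain
      _ ≤ ((R.totalDegree + c) * B ^ r + B ^ r * (m * degBound F)) * B :=
          Nat.mul_le_mul_right _ (Nat.add_le_add_right hU _)
      _ = _ := by ring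

/-- The elements of `{0, …, B - 1}` in the residue class `a`. -/
noncomputable def residueClass {N : ℕ} (a : ZMod N) (B : ℕ) : Finset ℤ :=
  (Finset.Ico 0 (B : ℤ)).filter fun x : ℤ => (x : ZMod N) = a

lemma abs_card_Ico_filter_sub_le {N : ℕ} (hN : 0 < N) (a : ZMod N) (B : ℕ) :
    |(((residueClass a B).card : ℕ) : ℝ) - B / N| ≤ 1 := by
  have hN' : (0 : ℤ) < N := by exact_mod_cast hN
  obtain ⟨v, rfl⟩ := ZMod.intCast_surjective a
  have h := Int.Ico_filter_modEq_card 0 (B : ℤ) hN' v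
  simp only [residueClass, ZMod.intCast_eq_intCast_iff]
  set k := {x ∈ Finset.Ico 0 (B : ℤ) | x ≡ v [ZMOD N]}.card
  set s : ℚ := ((B : ℤ) - v : ℚ) / (N : ℤ) with hs
  set t : ℚ := ((0 : ℤ) - v : ℚ) / (N : ℤ) with ht
  have hNq : (0 : ℚ) < (N : ℤ) := by exact_mod_cast hN
  have hst : s - t = (B : ℚ) / N := by
    rw [hs, ht]
    push_cast
    ring
  have hle : t ≤ s := by
    rw [← sub_nonneg, hst]
    positivity
  rw [max_eq_left (sub_nonneg.2 (Int.ceil_le_ceil hle))] at h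
  have hq : |(k : ℚ) - (B : ℚ) / N| ≤ 1 := by
    have h' : (k : ℚ) = ⌈s⌉ - ⌈t⌉ := by exact_mod_cast h
    rw [h', ← hst, abs_le]
    have := Int.le_ceil s
    have := Int.le_ceil t
    have := Int.ceil_lt_add_one s
    have := Int.ceil_lt_add_one t
    constructor <;> linarith
  have hr : ((|(k : ℚ) - (B : ℚ) / N| : ℚ) : ℝ) ≤ ((1 : ℚ) : ℝ) := Rat.cast_le.2 hq
  push_cast at hr
  exact hr

lemma card_box_filter_cast_eq {r N : ℕ} (B : ℕ) (v : Fin r → ZMod N) :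
    {n ∈ box r B | (fun j => (n j : ZMod N)) = v}.card =
      ∏ j, (residueClass (v j) B).card := by
  rw [← Fintype.card_piFinset]
  congr 1
  ext n
  simp [box, residueClass, Fintype.mem_piFinset, funext_iff, forall_and]

lemma card_box_filter_cast_mem {r N : ℕ} [NeZero N] (B : ℕ) (G : Finset (Fin r → ZMod N)) :
    {n ∈ box r B | (fun j => (n j : ZMod N)) ∈ G}.card =
      ∑ v ∈ G, ∏ j, (residueClass (v j) B).card := by
  refine (Finset.card_eq_sum_card_fiberwise
    (f := fun (n : Fin r → ℤ) (j : Fin r) => (n j : ZMod N)) (t := G)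
    fun n hn => (Finset.mem_filter.1 hn).2).trans ?_
  refine Finset.sum_congr rfl fun v hv => ?_
  rw [← card_box_filter_cast_eq, Finset.filter_filter]
  congr 1
  ext n
  simp only [Finset.mem_filter]
  refine and_congr_right fun _ => ⟨fun h => h.2, fun h => ⟨by rw [h]; exact hv, h⟩⟩

lemma tendsto_card_box_filter_cast_mem {r N : ℕ} [NeZero N] (G : Finset (Fin r → ZMod N)) :
    Tendsto (fun B : ℕ => ({n ∈ box r B | (fun j => (n j : ZMod N)) ∈ G}.card : ℝ) / (B : ℝ) ^ r)
      atTop (nhds ((G.card : ℝ) / (N : ℝ) ^ r)) := by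
  have hN : 0 < N := Nat.pos_of_neZero N
  have hone : ∀ a : ZMod N, Tendsto (fun B : ℕ =>
      ((residueClass a B).card : ℝ) / B) atTop (nhds (1 / (N : ℝ))) := by
    intro a
    rw [tendsto_iff_dist_tendsto_zero]
    refine squeeze_zero' (Eventually.of_forall fun _ => dist_nonneg) ?_
      tendsto_one_div_atTop_nhds_zero_nat
    filter_upwards [eventually_gt_atTop 0] with B hB
    have hB' : (0 : ℝ) < B := by exact_mod_cast hB
    have h := abs_card_Ico_filter_sub_le hN a B
    rw [Real.dist_eq, le_div_iff₀ hB', ← abs_of_pos hB', ← abs_mul, abs_of_pos hB']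
    have heq : (((residueClass a B).card : ℝ) / B - 1 / N) * B = (residueClass a B).card - B / N := by
      field_simp
    rwa [heq]
  have hlim : Tendsto (fun B : ℕ => ∑ v ∈ G, ∏ j,
      (((residueClass (v j) B).card : ℝ) / B)) atTop
      (nhds (∑ _v ∈ G, ∏ _j : Fin r, 1 / (N : ℝ))) :=
    tendsto_finsetSum _ fun v _ => tendsto_finsetProd _ fun j _ => hone (v j)
  convert hlim using 2
  · rw [card_box_filter_cast_mem]
    push_cast
    rw [Finset.sum_div]
    exact Finset.sum_congr rfl fun v _ => by simp [Finset.prod_div_distrib]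
  · simp [div_eq_mul_inv]

lemma card_box_filter_cast_mem_le {r N : ℕ} [NeZero N] {B : ℕ} (hNB : N ≤ B)
    (G : Finset (Fin r → ZMod N)) :
    ({n ∈ box r B | (fun j => (n j : ZMod N)) ∈ G}.card : ℝ) ≤ G.card * (2 * B / N) ^ r := by
  have hN : 0 < N := Nat.pos_of_neZero N
  have hN' : (0 : ℝ) < N := by exact_mod_cast hN
  rw [card_box_filter_cast_mem]
  push_cast
  rw [← nsmul_eq_mul]
  refine Finset.sum_le_card_nsmul _ _ _ fun v _ => ?_
  have hfin : Finset.card (Finset.univ : Finset (Fin r)) = r := by simp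
  conv_rhs => rw [← hfin, ← Finset.prod_const]
  refine Finset.prod_le_prod (fun _ _ => by positivity) fun j _ => ?_
  have h := (abs_le.1 (abs_card_Ico_filter_sub_le hN (v j) B)).2
  have h1 : (1 : ℝ) ≤ B / N := by
    rw [le_div_iff₀ hN']
    simpa using (by exact_mod_cast hNB : (N : ℝ) ≤ B)
  rw [mul_div_assoc]
  linarith

open Classical in
/-- The points of the box at which the members of `F` have no common prime factor in `S`. -/
noncomputable def sieved {r : ℕ} (F : Finset (MvPolynomial (Fin r) ℤ)) (S : Finset ℕ) (B : ℕ) :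
    Finset (Fin r → ℤ) :=
  (box r B).filter fun n => ∀ p ∈ S, ∃ P ∈ F, ¬ (p : ℤ) ∣ eval n P

lemma tendsto_card_sieved {r : ℕ} (F : Finset (MvPolynomial (Fin r) ℤ)) (S : Finset ℕ)
    (hS : ∀ p ∈ S, p.Prime) :
    Tendsto (fun B : ℕ => ((sieved F S B).card : ℝ) / (B : ℝ) ^ r) atTop
      (nhds (∏ p ∈ S, (1 - (zeroCount F p : ℝ) / (p : ℝ) ^ r))) := by
  classical
  have : ∀ p : S, NeZero (p : ℕ) := fun p => ⟨(hS p p.2).ne_zero⟩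
  have hcop : Pairwise (Function.onFun Nat.Coprime fun p : S => (p : ℕ)) := fun p q hpq =>
    (Nat.coprime_primes (hS p p.2) (hS q q.2)).2 fun h => hpq (Subtype.ext h)
  set N := ∏ p : S, (p : ℕ) with hN
  have hN0 : NeZero N := ⟨Finset.prod_ne_zero_iff.2 fun p _ => (hS p p.2).ne_zero⟩
  let e : ZMod N ≃+* ((p : S) → ZMod (p : ℕ)) := ZMod.prodEquivPi (fun p : S => (p : ℕ)) hcop
  let E : (Fin r → ZMod N) ≃ ((p : S) → Fin r → ZMod (p : ℕ)) :=
    (Equiv.piCongrRight fun _ => e.toEquiv).trans (Equiv.piComm _)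
  let good : (p : S) → Finset (Fin r → ZMod (p : ℕ)) := fun p =>
    Finset.univ.filter fun v => ¬ ∀ P ∈ F, aeval v P = 0
  let G : Finset (Fin r → ZMod N) := (Fintype.piFinset good).map E.symm.toEmbedding
  have hgood : ∀ p : S, ((good p).card : ℝ) = p ^ r - zeroCount F p := fun p => by
    have h := Finset.card_filter_add_card_filter_not (s := Finset.univ)
      (fun v : Fin r → ZMod (p : ℕ) => ∀ P ∈ F, aeval v P = 0)
    rw [← zeroCount_eq, Finset.card_univ, Fintype.card_fun, ZMod.card, Fintype.card_fin] at h
    rw [eq_sub_iff_add_eq, add_comm]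
    exact_mod_cast h
  have hlim := tendsto_card_box_filter_cast_mem G
  have hval : (G.card : ℝ) / (N : ℝ) ^ r =
      ∏ p ∈ S, (1 - (zeroCount F p : ℝ) / (p : ℝ) ^ r) := by
    rw [Finset.card_map, Fintype.card_piFinset, hN, ← Finset.prod_coe_sort S]
    push_cast
    rw [← Finset.prod_pow, ← Finset.prod_div_distrib]
    refine Finset.prod_congr rfl fun p _ => ?_
    have hp : ((p : ℕ) : ℝ) ^ r ≠ 0 := by
      exact_mod_cast pow_ne_zero r (hS p p.2).ne_zero
    rw [hgood, sub_div, div_self hp]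
  rw [hval] at hlim
  convert hlim using 5 with B
  refine Finset.filter_congr fun n _ => ?_
  simp only [G, Finset.mem_map_equiv, Equiv.symm_symm, Fintype.mem_piFinset, good,
    Finset.mem_filter, Finset.mem_univ, true_and]
  have hE : ∀ p : S, E (fun j => (n j : ZMod N)) p = fun j => (n j : ZMod (p : ℕ)) := fun p => by
    funext j
    have : e (n j : ZMod N) = (n j : (p : S) → ZMod (p : ℕ)) := map_intCast e (n j)
    exact (congrFun this p).trans (by simp)
  simp only [hE, ← natCast_dvd_eval_iff, Subtype.forall]
  push Not
  rfl

/-- Few points of the box have a common prime factor `p > M`. -/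
lemma IsCoprimeFamily.exists_card_tail_le {r : ℕ} {F : Finset (MvPolynomial (Fin r) ℤ)}
    (hF : IsCoprimeFamily F) : ∃ c : ℝ, ∀ M B : ℕ, 1 ≤ M → 1 ≤ B → ∀ T ⊆ box r B,
      (∀ n ∈ T, ∃ p : ℕ, p.Prime ∧ M < p ∧ ∀ P ∈ F, (p : ℤ) ∣ eval n P) →
      (T.card : ℝ) / (B : ℝ) ^ r ≤ c * (1 / M + 1 / B) := by
  classical
  obtain ⟨c, hc⟩ := hF.exists_zeroCount_le
  obtain ⟨d, hd⟩ := hF.exists_card_largeBad_le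
  refine ⟨2 ^ r * c + d, fun M B hM hB T hTB hT => ?_⟩
  have hM' : (0 : ℝ) < M := by exact_mod_cast hM
  have hB' : (0 : ℝ) < B := by exact_mod_cast hB
  let W : ℕ → Finset (Fin r → ℤ) := fun p => (box r B).filter fun n => ∀ P ∈ F, (p : ℤ) ∣ eval n P
  set S := (Finset.Ioc M B).filter Nat.Prime with hS
  have hcover : T ⊆ S.biUnion W ∪ largeBad F B := by
    intro n hn
    obtain ⟨p, hp, hMp, h⟩ := hT n hn
    rw [Finset.mem_union]
    rcases le_or_gt p B with hpB | hpB
    · exact Or.inl (Finset.mem_biUnion.2 ⟨p, Finset.mem_filter.2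
        ⟨Finset.mem_Ioc.2 ⟨hMp, hpB⟩, hp⟩, Finset.mem_filter.2 ⟨hTB hn, h⟩⟩)
    · exact Or.inr (mem_largeBad.2 ⟨hTB hn, p, hp, hpB.le, h⟩)
  have hW : ∀ p ∈ S, ((W p).card : ℝ) ≤ 2 ^ r * c * B ^ r * ((p : ℝ) ^ 2)⁻¹ := by
    intro p hp
    obtain ⟨hp1, hpp⟩ := Finset.mem_filter.1 hp
    have : NeZero p := ⟨hpp.ne_zero⟩
    have hp0 : (0 : ℝ) < p := by exact_mod_cast hpp.pos
    have h1 := card_box_filter_cast_mem_le (Finset.mem_Ioc.1 hp1).2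
      (Finset.univ.filter fun v : Fin r → ZMod p => ∀ P ∈ F, aeval v P = 0)
    rw [← zeroCount_eq] at h1
    have h2 : (zeroCount F p : ℝ) * p ^ 2 ≤ c * p ^ r := by exact_mod_cast hc p hpp
    have h3 : W p = (box r B).filter fun n => (fun j => (n j : ZMod p)) ∈
        Finset.univ.filter fun v : Fin r → ZMod p => ∀ P ∈ F, aeval v P = 0 :=
      Finset.filter_congr fun n _ => by simp [natCast_dvd_eval_iff]
    rw [h3]
    refine h1.trans ?_
    rw [← div_eq_mul_inv, le_div_iff₀ (by positivity), div_pow, mul_pow]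
    calc (zeroCount F p : ℝ) * (2 ^ r * (B : ℝ) ^ r / (p : ℝ) ^ r) * (p : ℝ) ^ 2
        = (zeroCount F p * (p : ℝ) ^ 2) * (2 ^ r * (B : ℝ) ^ r / (p : ℝ) ^ r) := by ring
      _ ≤ (c * (p : ℝ) ^ r) * (2 ^ r * (B : ℝ) ^ r / (p : ℝ) ^ r) := by gcongr
      _ = _ := by field_simp
  have hL : ((largeBad F B).card : ℝ) ≤ d * B ^ r * (1 / B) := by
    rw [mul_one_div, le_div_iff₀ hB']
    exact_mod_cast hd B
  have hsum : ∑ p ∈ S, ((p : ℝ) ^ 2)⁻¹ ≤ 1 / M := by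
    calc ∑ p ∈ S, ((p : ℝ) ^ 2)⁻¹ ≤ ∑ p ∈ Finset.Ioc M (max M B), ((p : ℝ) ^ 2)⁻¹ :=
          Finset.sum_le_sum_of_subset_of_nonneg ((Finset.filter_subset _ _).trans
            (Finset.Ioc_subset_Ioc_right (le_max_right _ _))) fun _ _ _ => by positivity
      _ ≤ (M : ℝ)⁻¹ - ((max M B : ℕ) : ℝ)⁻¹ := sum_Ioc_inv_sq_le_sub (by omega) (le_max_left _ _)
      _ ≤ 1 / M := by
          rw [one_div]
          exact sub_le_self _ (by positivity)
  rw [div_le_iff₀ (pow_pos hB' r)]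
  calc (T.card : ℝ) ≤ ((S.biUnion W ∪ largeBad F B).card : ℝ) := by
        exact_mod_cast Finset.card_le_card hcover
    _ ≤ ∑ p ∈ S, ((W p).card : ℝ) + (largeBad F B).card := by
        exact_mod_cast (Finset.card_union_le _ _).trans
          (Nat.add_le_add_right Finset.card_biUnion_le _)
    _ ≤ ∑ p ∈ S, 2 ^ r * c * B ^ r * ((p : ℝ) ^ 2)⁻¹ + d * B ^ r * (1 / B) :=
        add_le_add (Finset.sum_le_sum hW) hL
    _ ≤ 2 ^ r * c * B ^ r * (1 / M) + d * B ^ r * (1 / B) := by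
        rw [← Finset.mul_sum]
        gcongr
    _ ≤ (2 ^ r * c + d) * (1 / M + 1 / B) * B ^ r := by
        have h1 : (0 : ℝ) ≤ 2 ^ r * c * B ^ r * (1 / B) := by positivity
        have h2 : (0 : ℝ) ≤ d * B ^ r * (1 / M) := by positivity
        linarith

lemma one_sub_sum_le_prod_one_sub {ι : Type*} (s : Finset ι) (f : ι → ℝ)
    (h0 : ∀ i ∈ s, 0 ≤ f i) (h1 : ∀ i ∈ s, f i ≤ 1) :
    1 - ∑ i ∈ s, f i ≤ ∏ i ∈ s, (1 - f i) := by
  classical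
  induction s using Finset.induction_on with
  | empty => simp
  | insert a s ha ih =>
    simp only [Finset.mem_insert, forall_eq_or_imp] at h0 h1
    rw [Finset.sum_insert ha, Finset.prod_insert ha]
    have h := ih h0.2 h1.2
    have hs : 0 ≤ ∑ i ∈ s, f i := Finset.sum_nonneg h0.2
    nlinarith [mul_le_mul_of_nonneg_left h (sub_nonneg.2 h1.1), mul_nonneg h0.1 hs]

/-- The partial products of `∏ (1 - f p)` over the primes have a positive limit when
`f p = O(p⁻²)`. -/
lemma exists_pos_tendsto_prod_primes (f : ℕ → ℝ) (c : ℝ) (h0 : ∀ p : ℕ, p.Prime → 0 ≤ f p)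
    (h1 : ∀ p : ℕ, p.Prime → f p < 1) (hc : ∀ p : ℕ, p.Prime → f p ≤ c * ((p : ℝ) ^ 2)⁻¹) :
    ∃ L : ℝ, 0 < L ∧ Tendsto (fun M : ℕ => ∏ p ∈ (Finset.Ioc 0 M).filter Nat.Prime, (1 - f p))
      atTop (nhds L) := by
  set α : ℕ → ℝ := fun M => ∏ p ∈ (Finset.Ioc 0 M).filter Nat.Prime, (1 - f p) with hα
  have hpos : ∀ M, 0 < α M := fun M => Finset.prod_pos fun p hp =>
    sub_pos.2 (h1 p (Finset.mem_filter.1 hp).2)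
  have hsplit : ∀ M M' : ℕ, M ≤ M' →
      α M' = α M * ∏ p ∈ (Finset.Ioc M M').filter Nat.Prime, (1 - f p) := by
    intro M M' h
    simp only [hα]
    rw [← Finset.prod_union, ← Finset.filter_union, Finset.Ioc_union_Ioc_eq_Ioc (Nat.zero_le M) h]
    exact Finset.disjoint_filter_filter (Finset.Ioc_disjoint_Ioc_of_le le_rfl)
  have hanti : Antitone α := by
    intro M M' h
    rw [hsplit M M' h]
    refine mul_le_of_le_one_right (hpos M).le (Finset.prod_le_one (fun p hp => ?_) fun p hp => ?_)
    · exact (sub_pos.2 (h1 p (Finset.mem_filter.1 hp).2)).le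
    · exact sub_le_self _ (h0 p (Finset.mem_filter.1 hp).2)
  have hc0 : 0 ≤ c := by
    have h := (h0 2 Nat.prime_two).trans (hc 2 Nat.prime_two)
    exact nonneg_of_mul_nonneg_left h (by norm_num)
  obtain ⟨M, hM⟩ := exists_nat_gt (2 * c)
  have hM0 : (0 : ℝ) < M := by linarith
  have hlow : ∀ M', α M / 2 ≤ α M' := by
    intro M'
    rcases le_total M' M with h | h
    · exact (half_le_self (hpos M).le).trans (hanti h)
    rw [hsplit M M' h, div_eq_mul_one_div]
    refine mul_le_mul_of_nonneg_left ?_ (hpos M).le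
    refine le_trans ?_ (one_sub_sum_le_prod_one_sub _ f
      (fun p hp => h0 p (Finset.mem_filter.1 hp).2)
      fun p hp => (h1 p (Finset.mem_filter.1 hp).2).le)
    have hsum : ∑ p ∈ (Finset.Ioc M M').filter Nat.Prime, f p ≤ 1 / 2 :=
      calc _ ≤ ∑ p ∈ (Finset.Ioc M M').filter Nat.Prime, c * ((p : ℝ) ^ 2)⁻¹ :=
            Finset.sum_le_sum fun p hp => hc p (Finset.mem_filter.1 hp).2
        _ ≤ ∑ p ∈ Finset.Ioc M M', c * ((p : ℝ) ^ 2)⁻¹ :=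
            Finset.sum_le_sum_of_subset_of_nonneg (Finset.filter_subset _ _)
              fun _ _ _ => by positivity
        _ ≤ c * ((M : ℝ)⁻¹ - (M' : ℝ)⁻¹) := by
            rw [← Finset.mul_sum]
            exact mul_le_mul_of_nonneg_left
              (sum_Ioc_inv_sq_le_sub (by exact_mod_cast hM0.ne') h) hc0
        _ ≤ c * (M : ℝ)⁻¹ := mul_le_mul_of_nonneg_left (sub_le_self _ (by positivity)) hc0
        _ ≤ 1 / 2 := by
            rw [← div_eq_mul_inv, div_le_iff₀ hM0]
            linarith
    linarith
  have hbdd : BddBelow (Set.range α) := ⟨α M / 2, by rintro _ ⟨M', rfl⟩; exact hlow M'⟩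
  exact ⟨⨅ M, α M, (half_pos (hpos M)).trans_le (le_ciInf hlow), tendsto_atTop_ciInf hanti hbdd⟩

lemma tendsto_of_approx {a α : ℕ → ℝ} {A : ℕ → ℕ → ℝ} {c L : ℝ}
    (hA : ∀ M, Tendsto (A M) atTop (nhds (α M))) (hα : Tendsto α atTop (nhds L))
    (h : ∀ M B : ℕ, 1 ≤ M → 1 ≤ B → |A M B - a B| ≤ c * (1 / M + 1 / B)) :
    Tendsto a atTop (nhds L) := by
  rw [Metric.tendsto_atTop']
  intro ε hε
  have hinv : Tendsto (fun n : ℕ => c * (1 / (n : ℝ))) atTop (nhds 0) := by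
    simpa using tendsto_one_div_atTop_nhds_zero_nat.const_mul c
  have hsmall : ∀ᶠ n : ℕ in atTop, c * (1 / (n : ℝ)) < ε / 4 :=
    hinv.eventually_lt_const (by positivity)
  obtain ⟨M, hM1, hM2, hM3⟩ := ((eventually_ge_atTop 1).and
    (hsmall.and (Metric.tendsto_nhds.1 hα (ε / 4) (by positivity)))).exists
  obtain ⟨N, hN⟩ := eventually_atTop.1 ((eventually_ge_atTop 1).and
    (hsmall.and (Metric.tendsto_nhds.1 (hA M) (ε / 4) (by positivity))))
  refine ⟨N, fun B hB => ?_⟩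
  obtain ⟨hB1, hB2, hB3⟩ := hN B hB.le
  have h' := h M B hM1 hB1
  rw [Real.dist_eq] at hM3 hB3 ⊢
  rw [abs_lt] at hM3 hB3 ⊢
  rw [abs_le] at h'
  constructor <;> linarith [h'.1, h'.2, hM3.1, hM3.2, hB3.1, hB3.2]

lemma gcd_eq_one_iff {ι : Type*} (s : Finset ι) (f : ι → ℤ) :
    s.gcd f = 1 ↔ ∀ p : ℕ, p.Prime → ∃ i ∈ s, ¬ (p : ℤ) ∣ f i := by
  have hdvd : ∀ p : ℕ, (p : ℤ) ∣ s.gcd f ↔ ∀ i ∈ s, (p : ℤ) ∣ f i := fun p => Finset.dvd_gcd_iff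
  constructor
  · intro h p hp
    by_contra! hall
    have h1 := (hdvd p).2 hall
    rw [h, Int.natCast_dvd, Int.natAbs_one, Nat.dvd_one] at h1
    exact hp.one_lt.ne' h1
  · intro h
    by_contra hne
    have hnabs : (s.gcd f).natAbs ≠ 1 := by
      intro h1
      apply hne
      rw [← Finset.normalize_gcd, ← Int.abs_eq_normalize, Int.abs_eq_natAbs, h1, Nat.cast_one]
    obtain ⟨p, hp, hpd⟩ := Nat.exists_prime_and_dvd hnabs
    obtain ⟨i, hi, hni⟩ := h p hp
    exact hni ((hdvd p).1 (Int.natCast_dvd.2 hpd) i hi)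

/-- The density of the points at which the members of a coprime family without a fixed prime
divisor have no common prime factor. -/
lemma IsCoprimeFamily.exists_pos_density {r : ℕ} {F : Finset (MvPolynomial (Fin r) ℤ)}
    (hF : IsCoprimeFamily F)
    (hfix : ∀ p : ℕ, p.Prime → ∃ n : Fin r → ℤ, ∃ P ∈ F, ¬ (p : ℤ) ∣ eval n P)
    (D : ℕ → Finset (Fin r → ℤ))
    (hD : ∀ B n, n ∈ D B ↔ n ∈ box r B ∧ ∀ p : ℕ, p.Prime → ∃ P ∈ F, ¬ (p : ℤ) ∣ eval n P) :
    ∃ L : ℝ, 0 < L ∧ Tendsto (fun B : ℕ => ((D B).card : ℝ) / (B : ℝ) ^ r) atTop (nhds L) := by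
  classical
  obtain ⟨c, hc⟩ := hF.exists_zeroCount_le
  obtain ⟨d, hd⟩ := hF.exists_card_tail_le
  obtain ⟨L, hL, hlim⟩ := exists_pos_tendsto_prod_primes
    (fun p => (zeroCount F p : ℝ) / (p : ℝ) ^ r) c (fun p _ => by positivity)
    (fun p hp => by
      have : NeZero p := ⟨hp.ne_zero⟩
      have hp0 : (0 : ℝ) < p := by exact_mod_cast hp.pos
      rw [div_lt_one (by positivity)]
      obtain ⟨n, P, hP, hn⟩ := hfix p hp
      have hlt : zeroCount F p < p ^ r := by
        have hcard : (Finset.univ : Finset (Fin r → ZMod p)).card = p ^ r := by simp [ZMod.card]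
        rw [zeroCount_eq, ← hcard]
        refine Finset.card_lt_card ((Finset.filter_ssubset).2
          ⟨fun j => (n j : ZMod p), Finset.mem_univ _, fun h => hn ?_⟩)
        exact (natCast_dvd_eval_iff _ _ _).2 (h P hP)
      exact_mod_cast hlt)
    (fun p hp => by
      have hp0 : (0 : ℝ) < p := by exact_mod_cast hp.pos
      have h : (zeroCount F p : ℝ) * p ^ 2 ≤ c * p ^ r := by exact_mod_cast hc p hp
      rw [← div_eq_mul_inv, div_le_div_iff₀ (by positivity) (by positivity)]
      exact h)
  refine ⟨L, hL, tendsto_of_approx (c := d)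
    (fun M => tendsto_card_sieved F ((Finset.Ioc 0 M).filter Nat.Prime)
      fun p hp => (Finset.mem_filter.1 hp).2) hlim fun M B hM hB => ?_⟩
  set A := sieved F ((Finset.Ioc 0 M).filter Nat.Prime) B with hA
  have hmemA : ∀ n, n ∈ A ↔ n ∈ box r B ∧ ∀ p ∈ (Finset.Ioc 0 M).filter Nat.Prime,
      ∃ P ∈ F, ¬ (p : ℤ) ∣ eval n P := fun n => Finset.mem_filter
  have hsub : D B ⊆ A := fun n hn => (hmemA n).2
    ⟨((hD B n).1 hn).1, fun p hp => ((hD B n).1 hn).2 p (Finset.mem_filter.1 hp).2⟩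
  have hcard : ((A \ D B).card : ℝ) = A.card - (D B).card := by
    rw [Finset.card_sdiff_of_subset hsub, Nat.cast_sub (Finset.card_le_card hsub)]
  rw [← sub_div, ← hcard, abs_of_nonneg (by positivity)]
  refine hd M B hM hB _ (fun n hn => ((hmemA n).1 (Finset.mem_sdiff.1 hn).1).1) fun n hn => ?_
  obtain ⟨hnA, hnD⟩ := Finset.mem_sdiff.1 hn
  obtain ⟨hnb, hnS⟩ := (hmemA n).1 hnA
  rw [hD, not_and] at hnD
  have h := hnD hnb
  push Not at h
  obtain ⟨p, hp, hdvd⟩ := h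
  refine ⟨p, hp, ?_, hdvd⟩
  by_contra! hpM
  obtain ⟨P, hP, hnP⟩ := hnS p (Finset.mem_filter.2 ⟨Finset.mem_Ioc.2 ⟨hp.pos, hpM⟩, hp⟩)
  exact hnP (hdvd P hP)

end CoprimeValues

open CoprimeValues in
/-- Coprime polynomials with no fixed prime divisor take coprime values on a set
of positive density. -/
theorem stmt4 (s r : ℕ) (hs : 2 ≤ s) (hr : 1 ≤ r)
    (P : Fin s → MvPolynomial (Fin r) ℤ)
    (hP : ∀ i, P i ≠ 0)
    (hcop : ∀ D : MvPolynomial (Fin r) ℚ,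
      (∀ i, D ∣ (P i).map (Int.castRingHom ℚ)) → D.totalDegree = 0)
    (hnofix : ¬ ∃ p : ℕ, p.Prime ∧ ∀ (i : Fin s) (n : Fin r → ℤ), (p : ℤ) ∣ eval n (P i)) :
    ∃ L : ℝ, 0 < L ∧
      Tendsto (fun B : ℕ =>
        (Nat.card {n : Fin r → ℤ // (∀ j, 0 ≤ n j ∧ n j < (B : ℤ)) ∧
            (Finset.univ.gcd fun i => eval n (P i)) = 1} : ℝ) / (B : ℝ) ^ r)
        atTop (nhds L) := by
  classical
  have hF : IsCoprimeFamily (Finset.univ.image P) := by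
    intro D hD
    have hdvd : ∀ i, D ∣ P i := fun i => hD _ (Finset.mem_image_of_mem P (Finset.mem_univ i))
    have hdeg := hcop (D.map (Int.castRingHom ℚ)) fun i => map_dvd _ (hdvd i)
    have hdeg' : D.totalDegree = 0 := by
      rwa [totalDegree, support_map_of_injective _ (RingHom.injective_int _)] at hdeg
    have hDC := totalDegree_eq_zero_iff_eq_C.1 hdeg'
    refine ⟨_, fun h0 => ?_, hDC⟩
    rw [h0, C_0] at hDC
    exact hP ⟨0, by omega⟩ (zero_dvd_iff.1 (hDC ▸ hdvd _))
  let D : ℕ → Finset (Fin r → ℤ) := fun B =>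
    (box r B).filter fun n => (Finset.univ.gcd fun i => eval n (P i)) = 1
  obtain ⟨L, hL, hlim⟩ := hF.exists_pos_density
    (fun p hp => by
      by_contra! h
      exact hnofix ⟨p, hp, fun i n => h n _ (Finset.mem_image_of_mem P (Finset.mem_univ i))⟩)
    D (fun B n => by simp [D, gcd_eq_one_iff])
  refine ⟨L, hL, ?_⟩
  convert hlim using 4 with B
  rw [← Nat.card_eq_finsetCard]
  exact Nat.card_congr (Equiv.subtypeEquivRight fun n => by simp [D, mem_box])
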